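/- Let θ ∈ (0,2π) with θ/π irrational. Then there exists a dense subset S ⊆ (2,∞) such that for every s ∈ S and every ξ = (x,y,z) ∈ 𝔠_θ with z = s, there exists a word u ∈ F₂ that is palindromic and of non-torsion-type with u(A_ξ, B_ξ) = ±I (i.e., u ∈ ker ρ_ξ). -/

import Mathlib

/-- `SL(2,ℝ)`. -/
abbrev SL2R := Matrix.SpecialLinearGroup (Fin 2) ℝ

/-- The free group `F₂` on two generators. -/
abbrev F2 := FreeGroup Bool

/-- The generator `X` of `F₂`. -/
def Xg : F2 := FreeGroup.of true

/-- The generator `Y` of `F₂`. -/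
def Yg : F2 := FreeGroup.of false

/-- For `z > 2`, the unique real `ζ ≥ 1` with `ζ + ζ⁻¹ = z` (junk value `1` otherwise). -/
noncomputable def zetaOf (z : ℝ) : ℝ :=
  if 2 < z then (z + Real.sqrt (z ^ 2 - 4)) / 2 else 1

lemma zetaOf_ne_zero (z : ℝ) : zetaOf z ≠ 0 := by
  unfold zetaOf
  split_ifs with h
  · have h4 : (0:ℝ) ≤ Real.sqrt (z ^ 2 - 4) := Real.sqrt_nonneg _
    have : 0 < (z + Real.sqrt (z ^ 2 - 4)) / 2 := by nlinarith
    exact ne_of_gt this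
  · norm_num

/-- The normal-form matrix `A_ξ = [[x,−1],[1,0]]` as an element of `SL(2,ℝ)`. -/
noncomputable def Amat (x : ℝ) : SL2R :=
  ⟨!![x, -1; 1, 0], by simp [Matrix.det_fin_two_of]⟩

/-- The normal-form matrix `B_ξ = [[0,ζ⁻¹],[−ζ,y]]` as an element of `SL(2,ℝ)`. -/
noncomputable def Bmat (y z : ℝ) : SL2R :=
  ⟨!![0, (zetaOf z)⁻¹; -(zetaOf z), y], by
    simp [Matrix.det_fin_two_of]
    exact inv_mul_cancel₀ (zetaOf_ne_zero z)⟩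

/-- Evaluation of words: the homomorphism `F₂ → SL(2,ℝ)` sending `X ↦ A`, `Y ↦ B`. -/
noncomputable def ev (A B : SL2R) : F2 →* SL2R :=
  FreeGroup.lift (fun b => if b then A else B)

/-- The (lifted) holonomy representation of `ξ = (x,y,z)`: `w ↦ w(A_ξ, B_ξ)`. -/
noncomputable def rho (ξ : ℝ × ℝ × ℝ) : F2 →* SL2R :=
  ev (Amat ξ.1) (Bmat ξ.2.1 ξ.2.2)

/-- The Fricke–Klein space `𝔠_θ`. -/
def FK (θ : ℝ) : Set (ℝ × ℝ × ℝ) :=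
  {p | 2 < p.1 ∧ 2 < p.2.1 ∧ 2 < p.2.2 ∧
    p.1 ^ 2 + p.2.1 ^ 2 + p.2.2 ^ 2 - p.1 * p.2.1 * p.2.2 - 2 = -2 * Real.cos (θ / 2)}

/-- The full Fricke–Klein space `𝔠`. -/
def FKall : Set (ℝ × ℝ × ℝ) :=
  {p | 2 < p.1 ∧ 2 < p.2.1 ∧ 2 < p.2.2 ∧
    -2 < p.1 ^ 2 + p.2.1 ^ 2 + p.2.2 ^ 2 - p.1 * p.2.1 * p.2.2 - 2 ∧
    p.1 ^ 2 + p.2.1 ^ 2 + p.2.2 ^ 2 - p.1 * p.2.1 * p.2.2 - 2 < 2}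

/-- Trace of an element of `SL(2,ℝ)`. -/
noncomputable def trSL (A : SL2R) : ℝ := Matrix.trace (A : Matrix (Fin 2) (Fin 2) ℝ)
/-- Relators of the free Coxeter group `W = ℤ₂ * ℤ₂ * ℤ₂`. -/
def coxRels : Set (FreeGroup (Fin 3)) :=
  {FreeGroup.of 0 ^ 2, FreeGroup.of 1 ^ 2, FreeGroup.of 2 ^ 2}

/-- The free Coxeter group `W = ⟨P, Q, R ∣ P² = Q² = R² = 1⟩`. -/
abbrev W := PresentedGroup coxRels

/-- The generator `P` of `W`. -/
def Pg : W := PresentedGroup.of 0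

/-- The generator `Q` of `W`. -/
def Qg : W := PresentedGroup.of 1

/-- The generator `R` of `W`. -/
def Rg : W := PresentedGroup.of 2

/-- The embedding `ι : F₂ → W`, `X ↦ QR`, `Y ↦ RP`. -/
def iota : F2 →* W := FreeGroup.lift (fun b => if b then Qg * Rg else Rg * Pg)

/-- The automorphism of `F₂` inverting `X` and `Y`. -/
def sigXY : F2 →* F2 := FreeGroup.lift (fun b => (FreeGroup.of b)⁻¹)

/-- The endomorphism of `F₂` inverting `Y` and `Z = (XY)⁻¹`
(it sends `X ↦ Y⁻¹X⁻¹Y` and `Y ↦ Y⁻¹`, hence `Z ↦ Z⁻¹`). -/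
def sigYZ : F2 →* F2 := FreeGroup.lift (fun b => if b then Yg⁻¹ * Xg⁻¹ * Yg else Yg⁻¹)

/-- The endomorphism of `F₂` inverting `Z = (XY)⁻¹` and `X`
(it sends `X ↦ X⁻¹` and `Y ↦ XY⁻¹X⁻¹`, hence `Z ↦ Z⁻¹`). -/
def sigZX : F2 →* F2 := FreeGroup.lift (fun b => if b then Xg⁻¹ else Xg * Yg⁻¹ * Xg⁻¹)

/-- A word `u ∈ F₂` is palindromic if one of the three inversions sends it to `u⁻¹`. -/
def Palindromic (u : F2) : Prop := sigXY u = u⁻¹ ∨ sigYZ u = u⁻¹ ∨ sigZX u = u⁻¹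
/-- A word is of torsion-type if it lies in the normal closure of `{r^m}`
for some `r ≠ 1` and `m ≥ 2`. -/
def TorsionType (u : F2) : Prop :=
  ∃ r : F2, r ≠ 1 ∧ ∃ m : ℕ, 2 ≤ m ∧ u ∈ Subgroup.normalClosure {r ^ m}

/-- The action of `F₂` on a field `k` by affine maps, where `X` multiplies by the unit `x` and
`Y` adds `1`. -/
def affineAction {k : Type*} [Field k] (x : kˣ) : F2 →* Equiv.Perm k :=
  FreeGroup.lift fun b => if b then MulAction.toPerm x else Equiv.addRight 1

/-- The exponent sum of the generator `X` in a word. -/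
def expSumX : F2 →* Multiplicative ℤ :=
  FreeGroup.lift fun b => if b then Multiplicative.ofAdd 1 else 1

/-- The word `YXY⁻¹X⁻¹`. -/
def commYX : F2 := Yg * Xg * (Xg * Yg)⁻¹

/-- The word `Y⁻¹X⁻¹YX`. -/
def commInvYX : F2 := (Xg * Yg)⁻¹ * (Yg * Xg)

/-- The commutation relator between the half-turn inverting `X` and `Y` and the word
`K ^ a * K' ^ (2 * a + 1) * K ^ a`, where `K = Y⁻¹X⁻¹YX` and `K' = YXY⁻¹X⁻¹`. -/
def halfTurnRelator (a : ℤ) : F2 :=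
  commYX ^ a * commInvYX ^ (2 * a + 1) * commYX ^ a *
    (commInvYX ^ a * commYX ^ (2 * a + 1) * commInvYX ^ a)⁻¹

section NonTorsion

variable {k : Type*} [Field k] (x : kˣ)

@[simp]
lemma affineAction_Xg (v : k) : affineAction x Xg v = x * v := by
  simp [affineAction, Xg, Units.smul_def]

@[simp]
lemma affineAction_Yg (v : k) : affineAction x Yg v = v + 1 := by
  simp [affineAction, Yg]

@[simp]
lemma affineAction_Xg_inv (v : k) : (affineAction x Xg).symm v = (x : k)⁻¹ * v := by
  rw [Equiv.symm_apply_eq]; simp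

@[simp]
lemma affineAction_Yg_inv (v : k) : (affineAction x Yg).symm v = v - 1 := by
  rw [Equiv.symm_apply_eq]; simp

lemma exists_affineAction_eq (w : F2) :
    ∃ c : k, ∀ v, affineAction x w v = (x : k) ^ (expSumX w).toAdd * v + c := by
  induction w using FreeGroup.induction_on with
  | C1 => exact ⟨0, by simp⟩
  | of b =>
    cases b
    · exact ⟨1, fun v => by simpa [expSumX, Yg] using affineAction_Yg x v⟩
    · exact ⟨0, fun v => by simpa [expSumX, Xg] using affineAction_Xg x v⟩
  | inv_of b _ =>
    cases b
    · exact ⟨-1, fun v => by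
        simpa [expSumX, Yg, sub_eq_add_neg] using affineAction_Yg_inv x v⟩
    · exact ⟨0, fun v => by simpa [expSumX, Xg] using affineAction_Xg_inv x v⟩
  | mul w₁ w₂ h₁ h₂ =>
    obtain ⟨c₁, h₁⟩ := h₁
    obtain ⟨c₂, h₂⟩ := h₂
    refine ⟨(x : k) ^ (expSumX w₁).toAdd * c₂ + c₁, fun v => ?_⟩
    simp only [map_mul, Equiv.Perm.mul_apply, h₁, h₂, toAdd_mul, zpow_add₀ x.ne_zero]
    ring

lemma affineAction_pow_eq_one {r : F2} {m : ℕ}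
    (h : ∑ j ∈ Finset.range m, ((x : k) ^ (expSumX r).toAdd) ^ j = 0) :
    affineAction x (r ^ m) = 1 := by
  obtain ⟨c, hc⟩ := exists_affineAction_eq x r
  set q := (x : k) ^ (expSumX r).toAdd
  have key : ∀ (n : ℕ) (v : k),
      affineAction x (r ^ n) v = q ^ n * v + (∑ j ∈ Finset.range n, q ^ j) * c := by
    intro n
    induction n with
    | zero => simp
    | succ n ih =>
      intro v
      rw [pow_succ, map_mul, Equiv.Perm.mul_apply, hc, ih, Finset.sum_range_succ]
      ring
  have hq : q ^ m = 1 := by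
    have := geom_sum_mul q m
    rw [h, zero_mul] at this
    exact (sub_eq_zero.mp this.symm)
  ext v
  rw [key, h, hq]
  simp

lemma affineAction_commYX : affineAction x commYX = Equiv.addRight (1 - (x : k)) := by
  ext v
  have := x.ne_zero
  simp [commYX]
  field_simp
  ring

lemma affineAction_commInvYX :
    affineAction x commInvYX = Equiv.addRight ((x : k)⁻¹ - 1) := by
  ext v
  have := x.ne_zero
  simp [commInvYX]
  field_simp
  ring

lemma affineAction_halfTurnRelator_ne_one (hx : (x : k) ≠ 1) (a : ℤ) :
    affineAction x (halfTurnRelator a) ≠ 1 := by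
  intro h
  have h0 := congrArg (fun e : Equiv.Perm k => e 0) h
  have hx0 := x.ne_zero
  simp [halfTurnRelator, affineAction_commYX, affineAction_commInvYX, -zpow_neg] at h0
  have : ((x : k) - 1) ^ 2 = 0 := by
    field_simp at h0
    linear_combination h0
  exact hx (sub_eq_zero.mp (pow_eq_zero_iff two_ne_zero |>.mp this))

end NonTorsion

lemma exists_unit_geom_sum_eq_zero (i : ℤ) {m : ℕ} (hm : 2 ≤ m) :
    ∃ (k : Type) (_ : Field k) (x : kˣ), (x : k) ≠ 1 ∧
      ∑ j ∈ Finset.range m, ((x : k) ^ i) ^ j = 0 := by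
  by_cases hi : i = 0
  · have : Fact m.minFac.Prime := ⟨Nat.minFac_prime (by omega)⟩
    obtain ⟨y, hy⟩ := (Set.toFinite
      ({0, 1} : Set (AlgebraicClosure (ZMod m.minFac)))).exists_notMem
    simp only [Set.mem_insert_iff, Set.mem_singleton_iff, not_or] at hy
    refine ⟨AlgebraicClosure (ZMod m.minFac), inferInstance, Units.mk0 y hy.1, hy.2, ?_⟩
    have : CharP (AlgebraicClosure (ZMod m.minFac)) m.minFac := inferInstance
    simpa [hi] using (CharP.cast_eq_zero_iff _ m.minFac m).mpr m.minFac_dvd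
  · have hp := Complex.isPrimitiveRoot_exp m (by omega)
    have hxi : Complex.exp (2 * Real.pi * Complex.I / (m * i)) ^ i =
        Complex.exp (2 * Real.pi * Complex.I / m) := by
      rw [← Complex.exp_int_mul]
      congr 1
      have : (i : ℂ) ≠ 0 := by exact_mod_cast hi
      field_simp
    refine ⟨ℂ, inferInstance, Units.mk0 (Complex.exp (2 * Real.pi * Complex.I / (m * i)))
      (Complex.exp_ne_zero _), fun h => ?_, ?_⟩
    · rw [Units.val_mk0] at h
      rw [h, one_zpow] at hxi
      exact hp.ne_one (by omega) hxi.symm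
    · rw [Units.val_mk0, hxi]
      exact hp.geom_sum_eq_zero (by omega)

lemma not_torsionType_halfTurnRelator (a : ℤ) : ¬ TorsionType (halfTurnRelator a) := by
  rintro ⟨r, -, m, hm, hu⟩
  obtain ⟨k, _, x, hx, hsum⟩ := exists_unit_geom_sum_eq_zero (expSumX r).toAdd hm
  refine affineAction_halfTurnRelator_ne_one x hx a ?_
  have hle : Subgroup.normalClosure {r ^ m} ≤ (affineAction x).ker :=
    Subgroup.normalClosure_le_normal (by
      simpa [MonoidHom.mem_ker] using affineAction_pow_eq_one x hsum)
  exact hle hu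

lemma palindromic_halfTurnRelator (a : ℤ) : Palindromic (halfTurnRelator a) := by
  have hX : sigXY Xg = Xg⁻¹ := by simp [sigXY, Xg]
  have hY : sigXY Yg = Yg⁻¹ := by simp [sigXY, Yg]
  have h₁ : sigXY commYX = commInvYX := by simp [commYX, commInvYX, hX, hY, mul_assoc]
  have h₂ : sigXY commInvYX = commYX := by simp [commYX, commInvYX, hX, hY, mul_assoc]
  left
  simp [halfTurnRelator, h₁, h₂, mul_assoc]

section Rotations

open Matrix Real

local notation "M₂" => Matrix (Fin 2) (Fin 2) ℝ

lemma SL2R.coe_mul (A B : SL2R) : ((A * B : SL2R) : M₂) = A * B :=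
  Matrix.SpecialLinearGroup.coe_mul A B

lemma SL2R.coe_one : ((1 : SL2R) : M₂) = 1 :=
  Matrix.SpecialLinearGroup.coe_one

lemma coe_zpow_of_mul_self_eq_neg_one {K : SL2R} {J : M₂} {α : ℝ} (hJ : J * J = -1)
    (hK : (K : M₂) = cos α • 1 + sin α • J) (n : ℤ) :
    ((K ^ n : SL2R) : M₂) = cos (n * α) • 1 + sin (n * α) • J := by
  have hmul : ∀ a b : ℝ, (cos a • (1 : M₂) + sin a • J) * (cos b • 1 + sin b • J) =
      cos (a + b) • 1 + sin (a + b) • J := by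
    intro a b
    simp only [mul_add, add_mul, smul_mul_assoc, mul_smul_comm, mul_one, one_mul, hJ, cos_add,
      sin_add]
    module
  have hinv : ((K⁻¹ : SL2R) : M₂) = cos (-α) • 1 + sin (-α) • J := by
    have h1 : (K : M₂) * (cos (-α) • 1 + sin (-α) • J) = 1 := by
      rw [hK, hmul]; simp
    have h2 : ((K⁻¹ : SL2R) : M₂) * (K : M₂) = 1 := by
      rw [← SL2R.coe_mul, inv_mul_cancel, SL2R.coe_one]
    exact left_inv_eq_right_inv h2 h1
  induction n using Int.induction_on with
  | zero => simp
  | succ n ih =>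
    rw [_root_.zpow_add_one, SL2R.coe_mul, ih, hK, hmul]
    push_cast
    ring_nf
  | pred n ih =>
    rw [_root_.zpow_sub_one, SL2R.coe_mul, ih, hinv, hmul]
    push_cast
    ring_nf

lemma rotation_mul_rotation_mul_rotation {J J' : M₂} {C : ℝ} (hJ : J * J = -1)
    (hJJ' : J * J' + J' * J = -(2 * C) • (1 : M₂)) (φ β : ℝ) :
    (cos φ • (1 : M₂) + sin φ • J) * (cos β • 1 + sin β • J') * (cos φ • 1 + sin φ • J) =
      (cos β * cos (2 * φ) - C * sin β * sin (2 * φ)) • 1 +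
        (cos β * sin (2 * φ) - C * sin β * (1 - cos (2 * φ))) • J + sin β • J' := by
  have h1 : J' * J = -(2 * C) • (1 : M₂) - J * J' := by rw [← hJJ']; abel
  have h2 : J * J' * J = -(2 * C) • J + J' := by
    rw [mul_assoc, h1, mul_sub, ← mul_assoc, hJ]; simp
  have h3 : sin φ ^ 2 = 1 - cos φ ^ 2 := by rw [sin_sq]
  simp only [mul_add, add_mul, smul_mul_assoc, mul_smul_comm, mul_one, one_mul, hJ, h2, h1,
    cos_two_mul, sin_two_mul, smul_sub, smul_add, smul_smul, smul_neg]
  match_scalars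
  · linear_combination (-cos β) * h3
  · linear_combination (-2 * C * sin β) * h3
  · linear_combination (sin β) * h3
  · ring

lemma mul_self_eq_neg_one_of_trace {K : SL2R} {α : ℝ} (hα : sin α ≠ 0)
    (ht : trSL K = 2 * cos α) :
    ((sin α)⁻¹ • ((K : M₂) - cos α • 1)) * ((sin α)⁻¹ • ((K : M₂) - cos α • 1)) = -1 := by
  have hdet := K.2
  have hs := sin_sq_add_cos_sq α
  rw [det_fin_two] at hdet
  rw [trSL, trace_fin_two] at ht
  rw [smul_mul_smul_comm, eta_fin_two (K : M₂), one_fin_two]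
  generalize (K : M₂) 0 0 = p at *
  generalize (K : M₂) 0 1 = q at *
  generalize (K : M₂) 1 0 = r at *
  generalize (K : M₂) 1 1 = s at *
  obtain rfl : s = 2 * cos α - p := by linarith
  ext i j
  fin_cases i <;> fin_cases j <;> simp <;> field_simp
  · linear_combination (-1 : ℝ) * hdet + hs
  · right; ring
  · right; ring
  · linear_combination (-1 : ℝ) * hdet + hs

lemma anticommutator_of_trace {K K' : SL2R} {α C : ℝ} (hα : sin α ≠ 0)
    (ht : trSL K = 2 * cos α) (ht' : trSL K' = 2 * cos α)
    (htt' : trSL (K * K') = 2 * cos α ^ 2 - 2 * C * sin α ^ 2) :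
    ((sin α)⁻¹ • ((K : M₂) - cos α • 1)) * ((sin α)⁻¹ • ((K' : M₂) - cos α • 1)) +
      ((sin α)⁻¹ • ((K' : M₂) - cos α • 1)) * ((sin α)⁻¹ • ((K : M₂) - cos α • 1)) =
        -(2 * C) • (1 : M₂) := by
  rw [trSL, trace_fin_two] at ht ht'
  rw [trSL, SL2R.coe_mul, trace_fin_two, mul_apply, mul_apply, Fin.sum_univ_two,
    Fin.sum_univ_two] at htt'
  rw [smul_mul_smul_comm, smul_mul_smul_comm, eta_fin_two (K : M₂), eta_fin_two (K' : M₂),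
    one_fin_two]
  generalize (K : M₂) 0 0 = p at *
  generalize (K : M₂) 0 1 = q at *
  generalize (K : M₂) 1 0 = r at *
  generalize (K : M₂) 1 1 = s at *
  generalize (K' : M₂) 0 0 = p' at *
  generalize (K' : M₂) 0 1 = q' at *
  generalize (K' : M₂) 1 0 = r' at *
  generalize (K' : M₂) 1 1 = s' at *
  obtain rfl : s = 2 * cos α - p := by linarith
  obtain rfl : s' = 2 * cos α - p' := by linarith
  ext i j
  fin_cases i <;> fin_cases j <;> simp <;> field_simp
  · linear_combination htt'
  · ring_nf
  · ring_nf
  · linear_combination htt'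

/-- If `K` and `K'` are rotations by the same angle, then the palindromes `K ^ a * K' ^ b * K ^ a`
and `K' ^ a * K ^ b * K' ^ a` agree as soon as one scalar equation holds. -/
lemma palindrome_eq_swap {K K' : SL2R} {α C : ℝ} (hα : sin α ≠ 0)
    (ht : trSL K = 2 * cos α) (ht' : trSL K' = 2 * cos α)
    (htt' : trSL (K * K') = 2 * cos α ^ 2 - 2 * C * sin α ^ 2) {a b : ℤ}
    (hab : cos (b * α) * sin (2 * (a * α)) =
      sin (b * α) * (1 + C * (1 - cos (2 * (a * α))))) :
    K ^ a * K' ^ b * K ^ a = K' ^ a * K ^ b * K' ^ a := by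
  have hJ := mul_self_eq_neg_one_of_trace hα ht
  have hJ' := mul_self_eq_neg_one_of_trace hα ht'
  have hJJ' := anticommutator_of_trace hα ht ht' htt'
  have hK : (K : M₂) = cos α • 1 + sin α • ((sin α)⁻¹ • ((K : M₂) - cos α • 1)) := by
    rw [smul_inv_smul₀ hα]; abel
  have hK' : (K' : M₂) = cos α • 1 + sin α • ((sin α)⁻¹ • ((K' : M₂) - cos α • 1)) := by
    rw [smul_inv_smul₀ hα]; abel
  generalize (sin α)⁻¹ • ((K : M₂) - cos α • 1) = J at *
  generalize (sin α)⁻¹ • ((K' : M₂) - cos α • 1) = J' at *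
  have hJ'J := (add_comm _ _).trans hJJ'
  apply Subtype.ext
  simp only [SL2R.coe_mul, coe_zpow_of_mul_self_eq_neg_one hJ hK,
    coe_zpow_of_mul_self_eq_neg_one hJ' hK']
  rw [rotation_mul_rotation_mul_rotation hJ hJJ', rotation_mul_rotation_mul_rotation hJ' hJ'J]
  match_scalars
  · ring
  · linear_combination hab
  · linear_combination -hab

end Rotations

section Density

open Real Topology Filter

/-- The values `z > 2` of the boundary trace at which the rotations `ρ(Y⁻¹X⁻¹YX)` and
`ρ(YXY⁻¹X⁻¹)` by the angle `2α` satisfy one of the palindromic relations. -/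
def relationTraces (α : ℝ) : Set ℝ :=
  {s | 2 < s ∧ ∃ a : ℤ, cos ((2 * a + 1 : ℤ) * α) * sin (2 * (a * α)) =
    sin ((2 * a + 1 : ℤ) * α) *
      (1 + (s ^ 2 / (1 + cos α) - 1) * (1 - cos (2 * (a * α))))}

lemma exists_angle {α C : ℝ} (hα : 0 < sin α) (hC : 0 < C) :
    ∃ ω ∈ Set.Ioo 0 π, sin (ω + α) ≠ 0 ∧ cos ω ≠ 1 ∧
      cos (ω + α) * sin ω = sin (ω + α) * (1 + C * (1 - cos ω)) := by
  have hcont : ContinuousOn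
      (fun ω => cos (ω + α) * sin ω - sin (ω + α) * (1 + C * (1 - cos ω))) (Set.Icc 0 π) := by
    fun_prop
  obtain ⟨ω, hω, h0⟩ := intermediate_value_Ioo pi_pos.le hcont (show (0 : ℝ) ∈ Set.Ioo _ _ by
    simp only [zero_add, sin_zero, cos_zero, cos_pi, sin_pi, add_comm π, sin_add_pi]
    constructor <;> nlinarith)
  have hsin : 0 < sin ω := sin_pos_of_mem_Ioo hω
  replace h0 := sub_eq_zero.mp h0
  refine ⟨ω, hω, fun h => ?_, fun h => ?_, h0⟩
  · have h1 := sin_sq_add_cos_sq (ω + α)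
    rw [h, zero_mul, mul_eq_zero, or_iff_left hsin.ne'] at h0
    rw [h, h0] at h1
    norm_num at h1
  · have h1 := sin_sq_add_cos_sq ω
    rw [h] at h1
    nlinarith

lemma Ioi_two_subset_closure_relationTraces {α : ℝ} (hα : α ∈ Set.Ioo 0 π)
    (hirr : Irrational (α / π)) : Set.Ioi 2 ⊆ closure (relationTraces α) := by
  intro s₀ (hs₀ : 2 < s₀)
  have hsin : 0 < sin α := sin_pos_of_mem_Ioo hα
  have hcos : 0 < 1 + cos α := by nlinarith [sin_sq_add_cos_sq α, cos_le_one α, neg_one_le_cos α]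
  have hC : 0 < s₀ ^ 2 / (1 + cos α) - 1 := by
    rw [sub_pos, one_lt_div hcos]
    nlinarith [cos_le_one α]
  obtain ⟨ω₀, -, h₁, h₂, h₃⟩ := exists_angle hsin hC
  have h₂' : 1 - cos ω₀ ≠ 0 := sub_ne_zero.mpr h₂.symm
  set H : ℝ → ℝ := fun ω =>
    √(((cos (ω + α) * sin ω / sin (ω + α) - 1) / (1 - cos ω) + 1) * (1 + cos α))
  have hH₀ : H ω₀ = s₀ := by
    have : ((cos (ω₀ + α) * sin ω₀ / sin (ω₀ + α) - 1) / (1 - cos ω₀) + 1) * (1 + cos α) =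
        s₀ ^ 2 := by
      rw [h₃]
      field_simp
      ring
    simp only [H, this]
    exact sqrt_sq (by linarith)
  have hH : Tendsto H (𝓝 ω₀) (𝓝 s₀) := by
    have : ContinuousAt H ω₀ := by fun_prop (disch := assumption)
    simpa [ContinuousAt, hH₀] using this
  have hdense : Dense (AddSubgroup.closure {2 * α, 2 * π} : Set ℝ) := by
    rw [dense_addSubgroupClosure_pair_iff, mul_div_mul_left _ _ two_ne_zero]
    exact hirr
  rw [mem_closure_iff_frequently]
  refine hH.frequently ?_
  have e₁ : ∀ᶠ ω in 𝓝 ω₀, sin (ω + α) ≠ 0 :=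
    ContinuousAt.eventually_ne (g := fun ω => sin (ω + α)) (by fun_prop) h₁
  have e₂ : ∀ᶠ ω in 𝓝 ω₀, 1 - cos ω ≠ 0 :=
    ContinuousAt.eventually_ne (g := fun ω => 1 - cos ω) (by fun_prop) h₂'
  refine ((mem_closure_iff_frequently.mp (hdense ω₀)).and_eventually
    (e₁.and (e₂.and (hH.eventually_const_lt hs₀)))).mono ?_
  rintro ω ⟨hω, h₁, h₂, h₃⟩
  refine ⟨h₃, ?_⟩
  obtain ⟨a, n, rfl⟩ := AddSubgroup.mem_closure_pair.mp hω
  refine ⟨a, ?_⟩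
  have hHsq : H (a • (2 * α) + n • (2 * π)) ^ 2 = _ := sq_sqrt (sqrt_pos.mp (by linarith)).le
  have ha : a • (2 * α) + n • (2 * π) = 2 * (a * α) + n * (2 * π) := by
    simp only [zsmul_eq_mul]; ring
  have hb : 2 * (a * α) + n * (2 * π) + α = (2 * a + 1 : ℤ) * α + n * (2 * π) := by
    push_cast; ring
  rw [hHsq]
  simp only [ha, hb, cos_add_int_mul_two_pi, sin_add_int_mul_two_pi] at h₁ h₂ ⊢
  generalize 2 * (a * α) = ψ at *
  generalize (2 * a + 1 : ℤ) * α = β at *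
  field_simp
  ring

end Density

section Holonomy

open Matrix

variable {x y z : ℝ}

lemma zetaOf_add_inv (hz : 2 < z) : zetaOf z + (zetaOf z)⁻¹ = z := by
  have h : zetaOf z ^ 2 + 1 = z * zetaOf z := by
    have := Real.sq_sqrt (show 0 ≤ z ^ 2 - 4 by nlinarith)
    rw [zetaOf, if_pos hz]
    linear_combination this / 4
  have := zetaOf_ne_zero z
  field_simp
  linarith

lemma coe_rho_XY : (rho (x, y, z) (Xg * Yg) : Matrix (Fin 2) (Fin 2) ℝ) =
    !![zetaOf z, x * (zetaOf z)⁻¹ - y; 0, (zetaOf z)⁻¹] := by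
  rw [map_mul, SL2R.coe_mul]
  simp [rho, ev, Xg, Yg, Amat, Bmat, sub_eq_add_neg]

lemma coe_rho_YX : (rho (x, y, z) (Yg * Xg) : Matrix (Fin 2) (Fin 2) ℝ) =
    !![(zetaOf z)⁻¹, 0; y - zetaOf z * x, zetaOf z] := by
  rw [map_mul, SL2R.coe_mul]
  simp [rho, ev, Xg, Yg, Amat, Bmat, sub_eq_add_neg, add_comm]

lemma coe_rho_XY_inv : (rho (x, y, z) (Xg * Yg)⁻¹ : Matrix (Fin 2) (Fin 2) ℝ) =
    !![(zetaOf z)⁻¹, y - x * (zetaOf z)⁻¹; 0, zetaOf z] := by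
  rw [map_inv]
  refine (Matrix.SpecialLinearGroup.coe_inv _).trans ?_
  rw [coe_rho_XY, adjugate_fin_two_of]
  simp

lemma coe_rho_commYX : (rho (x, y, z) commYX : Matrix (Fin 2) (Fin 2) ℝ) =
    !![(zetaOf z)⁻¹, 0; y - zetaOf z * x, zetaOf z] *
      !![(zetaOf z)⁻¹, y - x * (zetaOf z)⁻¹; 0, zetaOf z] := by
  rw [commYX, map_mul, SL2R.coe_mul, coe_rho_YX, coe_rho_XY_inv]

lemma coe_rho_commInvYX : (rho (x, y, z) commInvYX : Matrix (Fin 2) (Fin 2) ℝ) =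
    !![(zetaOf z)⁻¹, y - x * (zetaOf z)⁻¹; 0, zetaOf z] *
      !![(zetaOf z)⁻¹, 0; y - zetaOf z * x, zetaOf z] := by
  rw [commInvYX, map_mul, SL2R.coe_mul, coe_rho_YX, coe_rho_XY_inv]

lemma trSL_rho_commYX (hz : 2 < z) :
    trSL (rho (x, y, z) commYX) = x ^ 2 + y ^ 2 + z ^ 2 - x * y * z - 2 := by
  have h := zetaOf_ne_zero z
  have hζ := zetaOf_add_inv hz
  rw [trSL, coe_rho_commYX, trace_fin_two]
  generalize zetaOf z = ζ at *
  subst hζ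
  simp
  field_simp
  ring

lemma trSL_rho_commInvYX (hz : 2 < z) :
    trSL (rho (x, y, z) commInvYX) = x ^ 2 + y ^ 2 + z ^ 2 - x * y * z - 2 := by
  rw [← trSL_rho_commYX hz, trSL, trSL, coe_rho_commInvYX, coe_rho_commYX, trace_mul_comm]

lemma trSL_rho_commInvYX_mul_commYX (hz : 2 < z) :
    trSL (rho (x, y, z) commInvYX * rho (x, y, z) commYX) =
      z ^ 2 * (x ^ 2 + y ^ 2 + z ^ 2 - x * y * z - 4) + 2 := by
  have h := zetaOf_ne_zero z
  have hζ := zetaOf_add_inv hz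
  rw [trSL, SL2R.coe_mul, coe_rho_commYX, coe_rho_commInvYX, trace_fin_two]
  generalize zetaOf z = ζ at *
  subst hζ
  simp
  field_simp
  ring

end Holonomy

/-- For `θ ∈ (0,2π)` with `θ/π` irrational, there is a dense subset
`S ⊆ (2,∞)` such that every `ξ ∈ 𝔠_θ` with `z`-coordinate in `S` has a palindromic
non-torsion-type word in `ker ρ_ξ`. -/
theorem stmt_12 (θ : ℝ) (hθ : θ ∈ Set.Ioo 0 (2 * Real.pi))
    (hirr : Irrational (θ / Real.pi)) :
    ∃ S : Set ℝ, S ⊆ Set.Ioi 2 ∧ Set.Ioi (2:ℝ) ⊆ closure S ∧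
      ∀ s ∈ S, ∀ ξ ∈ FK θ, ξ.2.2 = s →
        ∃ u : F2, Palindromic u ∧ ¬ TorsionType u ∧
          ((rho ξ u : Matrix (Fin 2) (Fin 2) ℝ) = 1 ∨
           (rho ξ u : Matrix (Fin 2) (Fin 2) ℝ) = -1) := by
  set α := Real.pi - θ / 2 with hα
  have hαmem : α ∈ Set.Ioo 0 Real.pi := ⟨by linarith [hθ.2], by linarith [hθ.1]⟩
  have hαirr : Irrational (α / Real.pi) := by
    have h : α / Real.pi = (1 : ℕ) - θ / Real.pi / (2 : ℕ) := by
      rw [hα]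
      field_simp
      push_cast
      ring
    rw [h]
    exact (hirr.div_natCast two_ne_zero).natCast_sub 1
  have hsin : Real.sin α ≠ 0 := (Real.sin_pos_of_mem_Ioo hαmem).ne'
  have hcos : 1 + Real.cos α ≠ 0 := fun h => by
    have h1 := Real.sin_sq_add_cos_sq α
    rw [show Real.cos α = -1 by linarith] at h1
    exact hsin (pow_eq_zero_iff two_ne_zero |>.mp (by linarith))
  refine ⟨relationTraces α, fun s hs => hs.1,
    Ioi_two_subset_closure_relationTraces hαmem hαirr, ?_⟩
  rintro s ⟨hs, a, ha⟩ ⟨x, y, z⟩ ⟨-, -, -, hκ⟩ rfl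
  refine ⟨halfTurnRelator a, palindromic_halfTurnRelator a, not_torsionType_halfTurnRelator a,
    Or.inl ?_⟩
  have hκα : x ^ 2 + y ^ 2 + z ^ 2 - x * y * z - 2 = 2 * Real.cos α := by
    rw [hα, Real.cos_pi_sub]
    linear_combination hκ
  have htr : trSL (rho (x, y, z) commInvYX * rho (x, y, z) commYX) =
      2 * Real.cos α ^ 2 - 2 * (z ^ 2 / (1 + Real.cos α) - 1) * Real.sin α ^ 2 := by
    rw [trSL_rho_commInvYX_mul_commYX hs, Real.sin_sq]
    field_simp
    linear_combination (1 + Real.cos α) * z ^ 2 * hκα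
  have hrel := palindrome_eq_swap hsin ((trSL_rho_commInvYX hs).trans hκα)
    ((trSL_rho_commYX hs).trans hκα) htr ha
  have hone : rho (x, y, z) (halfTurnRelator a) = 1 := by
    simp only [halfTurnRelator, map_mul, map_inv, map_zpow]
    rw [hrel, mul_inv_cancel]
  rw [hone, SL2R.coe_one]
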